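/- (Counting Lemma) Let k ≥ 1, s ≥ k and n ≥ ks+k−1, and let 𝓕 be a stable and saturated family of k-element subsets of [n] with ν(𝓕) = s. Suppose [ks+k−1] is partitioned as D ∪ F₁ ∪ ⋯ ∪ F_s where F₁,…,F_s ∈ 𝓕 are pairwise disjoint and |D| = k−1. For H ∈ 𝓕₀ = { F ∩ [ks+k−1] : F ∈ 𝓕 }, let the width v(H) = |{ i ∈ [s] : H ∩ F_i ≠ ∅ }| and the weight w(H) = C(n−ks−k+1, k−|H|) / C(s−v(H), k−v(H)) ∈ ℚ. For R ⊆ [s] let X(R) = D ∪ ⋃_{r∈R} F_r and 𝓗(R) = { H ∈ 𝓕₀ : H ⊆ X(R) }. Then |𝓕| = Σ_{R a k-element subset of [s]} Σ_{H ∈ 𝓗(R)} w(H). -/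

import Mathlib

/-- The matching number of a family of finite sets: the maximum number of
pairwise disjoint nonempty members. -/
noncomputable def matchNum (𝓕 : Finset (Finset ℕ)) : ℕ :=
  sSup {m | ∃ M ⊆ 𝓕, M.card = m ∧ (∀ A ∈ M, A.Nonempty) ∧
    (M : Set (Finset ℕ)).Pairwise fun A B => Disjoint A B}

/-- A family of subsets of `[n] = {1,…,n}` is stable if it is closed downwards
under the "shifting" partial order: whenever `F ∈ 𝓕` and `G ⊆ [n]` admits a
bijection `φ : F → G` with `φ x ≤ x` for all `x ∈ F`, then `G ∈ 𝓕`. -/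
def Stable (n : ℕ) (𝓕 : Finset (Finset ℕ)) : Prop :=
  ∀ F ∈ 𝓕, ∀ G : Finset ℕ, G ⊆ Finset.Icc 1 n → G.card = F.card →
    (∃ φ : ℕ → ℕ, Set.BijOn φ (F : Set ℕ) (G : Set ℕ) ∧ ∀ x ∈ F, φ x ≤ x) → G ∈ 𝓕

/-- A family of `k`-element subsets of `[n]` is saturated if adding any new
`k`-element subset of `[n]` increases the matching number. -/
def Saturated (n k : ℕ) (𝓕 : Finset (Finset ℕ)) : Prop :=
  ∀ E : Finset ℕ, E ⊆ Finset.Icc 1 n → E.card = k → E ∉ 𝓕 →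
    matchNum 𝓕 < matchNum (insert E 𝓕)

/-- Two finite sets of the same size are matched by a map that is the identity elsewhere. -/
theorem Finset.exists_bijOn_of_card_eq {α : Type*} {A B : Finset α}
    (h : A.card = B.card) :
    ∃ φ : α → α, Set.BijOn φ (A : Set α) (B : Set α) ∧ ∀ x ∉ A, φ x = x := by
  classical
  let e := Finset.equivOfCardEq h
  refine ⟨fun x => if hx : x ∈ A then (e ⟨x, hx⟩ : α) else x, ⟨?_, ?_, ?_⟩, ?_⟩
  · intro x hx
    have hx' : x ∈ A := hx
    simp [hx']
  · intro x hx y hy hxy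
    have hx' : x ∈ A := hx
    have hy' : y ∈ A := hy
    simpa [hx', hy', Subtype.ext_iff] using hxy
  · intro y hy
    refine ⟨(e.symm ⟨y, hy⟩ : α), (e.symm ⟨y, hy⟩).2, ?_⟩
    simp
  · intro x hx
    simp [hx]

theorem bddAbove_matching_card (𝓕 : Finset (Finset ℕ)) :
    BddAbove {m | ∃ M ⊆ 𝓕, M.card = m ∧ (∀ A ∈ M, A.Nonempty) ∧
      (M : Set (Finset ℕ)).Pairwise fun A B => Disjoint A B} := by
  refine ⟨𝓕.card, ?_⟩
  rintro _ ⟨M, hM, rfl, -⟩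
  exact Finset.card_le_card hM

theorem card_le_matchNum {𝓕 M : Finset (Finset ℕ)} (hM : M ⊆ 𝓕)
    (hne : ∀ A ∈ M, A.Nonempty)
    (hd : (M : Set (Finset ℕ)).Pairwise fun A B => Disjoint A B) :
    M.card ≤ matchNum 𝓕 :=
  le_csSup (bddAbove_matching_card 𝓕) ⟨M, hM, rfl, hne, hd⟩

theorem exists_matching_card_eq_matchNum (𝓕 : Finset (Finset ℕ)) :
    ∃ M ⊆ 𝓕, M.card = matchNum 𝓕 ∧ (∀ A ∈ M, A.Nonempty) ∧
      (M : Set (Finset ℕ)).Pairwise fun A B => Disjoint A B :=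
  Nat.sSup_mem (s := {m | ∃ M ⊆ 𝓕, M.card = m ∧ (∀ A ∈ M, A.Nonempty) ∧
    (M : Set (Finset ℕ)).Pairwise fun A B => Disjoint A B})
    ⟨0, ∅, by simp⟩ (bddAbove_matching_card 𝓕)

/-- If adding `E` increases the matching number, then some maximum matching avoids `E`. -/
theorem exists_matching_disjoint_of_matchNum_lt {𝓕 : Finset (Finset ℕ)} {E : Finset ℕ}
    (h : matchNum 𝓕 < matchNum (insert E 𝓕)) :
    ∃ M ⊆ 𝓕, M.card = matchNum 𝓕 ∧ (∀ A ∈ M, A.Nonempty) ∧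
      (M : Set (Finset ℕ)).Pairwise (fun A B => Disjoint A B) ∧ ∀ A ∈ M, Disjoint A E := by
  obtain ⟨M, hM, hcard, hne, hd⟩ := exists_matching_card_eq_matchNum (insert E 𝓕)
  have hE : E ∈ M := by
    by_contra hE
    have := card_le_matchNum ((Finset.subset_insert_iff_of_notMem hE).1 hM) hne hd
    omega
  have hsub : M.erase E ⊆ 𝓕 := Finset.subset_insert_iff.1 hM
  have hne' : ∀ A ∈ M.erase E, A.Nonempty := fun A hA => hne A (Finset.mem_of_mem_erase hA)
  have hd' : (M.erase E : Set (Finset ℕ)).Pairwise fun A B => Disjoint A B :=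
    hd.mono (Finset.coe_subset.2 (Finset.erase_subset E M))
  have hle := card_le_matchNum hsub hne' hd'
  have hc := Finset.card_erase_add_one hE
  exact ⟨M.erase E, hsub, by omega, hne', hd', fun A hA =>
    hd (Finset.mem_of_mem_erase hA) hE (Finset.ne_of_mem_erase hA)⟩

/-- A stable family is closed under replacing some elements by smaller ones. -/
theorem Stable.mem_of_exchange {n : ℕ} {𝓕 : Finset (Finset ℕ)} (hst : Stable n 𝓕)
    {F G : Finset ℕ} (hF : F ∈ 𝓕) (hG : G ⊆ Finset.Icc 1 n) (hcard : G.card = F.card)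
    (h : ∀ x ∈ F \ G, ∀ y ∈ G \ F, y ≤ x) : G ∈ 𝓕 := by
  obtain ⟨φ, hφ, hid⟩ :=
    Finset.exists_bijOn_of_card_eq (Finset.card_sdiff_comm hcard.symm)
  have hfix : Set.BijOn φ (F ∩ G : Finset ℕ) (F ∩ G : Finset ℕ) :=
    (Set.bijOn_id _).congr fun x hx => (hid x (by
      simp only [Finset.coe_inter, Set.mem_inter_iff, Finset.mem_coe] at hx
      simp [hx])).symm
  refine hst F hF G hG hcard ⟨φ, ?_, fun x hx => ?_⟩
  · have hinj : Set.InjOn φ (((F \ G : Finset ℕ) : Set ℕ) ∪ (F ∩ G : Finset ℕ)) := by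
      refine (Set.injOn_union ?_).2 ⟨hφ.injOn, hfix.injOn, fun x hx y hy hxy => ?_⟩
      · exact Finset.disjoint_coe.2 (Finset.disjoint_sdiff_inter F G)
      · have h1 := hφ.mapsTo hx
        have h2 := hfix.mapsTo hy
        rw [hxy] at h1
        simp only [Finset.mem_coe, Finset.mem_sdiff, Finset.mem_inter] at h1 h2
        exact h1.2 h2.1
    have := hφ.union hfix hinj
    rwa [← Finset.coe_union, ← Finset.coe_union, Finset.sdiff_union_inter,
      Finset.inter_comm F G, Finset.sdiff_union_inter] at this
  · by_cases hxG : x ∈ G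
    · exact (hid x (by simp [hxG])).le
    · have hx' : x ∈ F \ G := Finset.mem_sdiff.2 ⟨hx, hxG⟩
      exact h x hx' _ (hφ.mapsTo hx')

/-- A maximum matching avoiding a `k`-set `G` can be shifted into a larger one as soon as the
family contains a set with the same trace as `G` on `[ks+k-1]` which leaves that interval. -/
theorem Stable.not_exists_matching_disjoint {k s n : ℕ} (hn : k * s + k - 1 ≤ n)
    {𝓕 : Finset (Finset ℕ)} (h𝓕 : 𝓕 ⊆ Finset.powersetCard k (Finset.Icc 1 n))
    (hst : Stable n 𝓕) (hν : matchNum 𝓕 = s) {F G : Finset ℕ} (hF : F ∈ 𝓕)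
    (htr : F ∩ Finset.Icc 1 (k * s + k - 1) = G ∩ Finset.Icc 1 (k * s + k - 1))
    {f : ℕ} (hfF : f ∈ F) (hf : f ∉ Finset.Icc 1 (k * s + k - 1))
    {M : Finset (Finset ℕ)} (hM : M ⊆ 𝓕) (hcard : M.card = s)
    (hne : ∀ A ∈ M, A.Nonempty)
    (hd : (M : Set (Finset ℕ)).Pairwise fun A B => Disjoint A B)
    (hMG : ∀ A ∈ M, Disjoint A G) : False := by
  have hmem : ∀ A ∈ 𝓕, A ⊆ Finset.Icc 1 n ∧ A.card = k := fun A hA =>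
    Finset.mem_powersetCard.1 (h𝓕 hA)
  obtain ⟨hFn, hFk⟩ := hmem F hF
  set I := Finset.Icc 1 (k * s + k - 1) with hI
  have hIn : I ⊆ Finset.Icc 1 n := Finset.Icc_subset_Icc_right hn
  have hIcard : I.card = k * s + k - 1 := by simp [hI]
  have hout : ∀ x ∈ Finset.Icc 1 n, x ∉ I → ∀ y ∈ I, y ≤ x := by
    intro x hx hxI y hy
    simp only [hI, Finset.mem_Icc] at hx hxI hy
    omega
  set W := M.biUnion id with hW
  have hWcard : W.card = k * s := by
    rw [hW, Finset.card_biUnion (t := id) (fun A hA B hB hAB => hd hA hB hAB),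
      Finset.sum_const_nat (m := k) (f := fun u => (id u).card) (fun A hA => (hmem A (hM hA)).2), hcard, mul_comm]
  have hWn : W ⊆ Finset.Icc 1 n := Finset.biUnion_subset.2 fun A hA => (hmem A (hM hA)).1
  have hsubW : ∀ A ∈ M, A ⊆ W := fun A hA => Finset.subset_biUnion_of_mem id hA
  have hWG : Disjoint W G := (Finset.disjoint_biUnion_left _ _ _).2 hMG
  have hHlt : (F ∩ I).card < k := by
    rw [← hFk]
    exact Finset.card_lt_card
      ⟨Finset.inter_subset_left, fun h => hf (Finset.mem_inter.1 (h hfF)).2⟩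
  have hScard : (I \ (W ∪ G)).card + (W ∩ I).card + (F ∩ I).card = k * s + k - 1 := by
    have h1 := Finset.card_sdiff_add_card_inter I (W ∪ G)
    rw [Finset.inter_union_distrib_left, Finset.inter_comm I W, Finset.inter_comm I G,
      Finset.card_union_of_disjoint
        (hWG.mono Finset.inter_subset_left Finset.inter_subset_left), ← htr, hIcard] at h1
    omega
  have hOcard := Finset.card_sdiff_add_card_inter W I
  obtain ⟨T, hTS, hT⟩ :=
    Finset.exists_subset_card_eq (s := I \ (W ∪ G)) (n := (W \ I).card) (by omega)
  have hS₂ := Finset.card_sdiff_add_card_eq_card hTS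
  obtain ⟨φ, hφ, hid⟩ := Finset.exists_bijOn_of_card_eq hT.symm
  have hTmem : ∀ x ∈ T, x ∈ I ∧ x ∉ W ∧ x ∉ G := fun x hx => by
    have := hTS hx
    simpa using this
  have hφcases : ∀ x ∈ W, (x ∈ I ∧ φ x = x) ∨ (x ∉ I ∧ φ x ∈ T) := fun x hx => by
    by_cases hxI : x ∈ I
    · exact Or.inl ⟨hxI, hid x (by simp [hxI])⟩
    · exact Or.inr ⟨hxI, hφ.mapsTo (by simp [hx, hxI])⟩
  have hφI : ∀ x ∈ W, φ x ∈ I := fun x hx => by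
    rcases hφcases x hx with ⟨h1, h2⟩ | ⟨-, h2⟩
    · rwa [h2]
    · exact (hTmem _ h2).1
  have hinj : Set.InjOn φ (W : Set ℕ) := by
    intro x hx y hy hxy
    rcases hφcases x hx with ⟨h1, h2⟩ | ⟨h1, h2⟩ <;>
      rcases hφcases y hy with ⟨h3, h4⟩ | ⟨h3, h4⟩
    · rw [← h2, hxy, h4]
    · rw [← hxy, h2] at h4
      exact absurd hx (hTmem _ h4).2.1
    · rw [hxy, h4] at h2
      exact absurd hy (hTmem _ h2).2.1
    · exact hφ.injOn (Finset.mem_coe.2 (Finset.mem_sdiff.2 ⟨hx, h1⟩))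
        (Finset.mem_coe.2 (Finset.mem_sdiff.2 ⟨hy, h3⟩)) hxy
  have hφ𝓕 : ∀ A ∈ M, A.image φ ∈ 𝓕 := fun A hA => by
    have hinjA : Set.InjOn φ (A : Set ℕ) := hinj.mono (Finset.coe_subset.2 (hsubW A hA))
    refine hst A (hM hA) _ ?_ (Finset.card_image_of_injOn hinjA) ⟨φ, ?_, fun x hx => ?_⟩
    · exact Finset.image_subset_iff.2 fun x hx => hIn (hφI x (hsubW A hA hx))
    · rw [Finset.coe_image]
      exact hinjA.bijOn_image
    · have hxW := hsubW A hA hx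
      rcases hφcases x hxW with ⟨-, h2⟩ | ⟨h1, -⟩
      · exact h2.le
      · exact hout x (hWn hxW) h1 _ (hφI x hxW)
  set S₂ := (I \ (W ∪ G)) \ T with hS₂def
  have hS₂mem : ∀ x ∈ S₂, x ∈ I ∧ x ∉ W ∧ x ∉ G ∧ x ∉ T := fun x hx => by
    simp only [hS₂def, Finset.mem_sdiff, Finset.mem_union, not_or] at hx
    tauto
  set G' := insert f (F ∩ I ∪ S₂) with hG'
  have hdisjS : Disjoint (F ∩ I) S₂ := by
    rw [htr]
    exact Finset.disjoint_left.2 fun x hx hx' => (hS₂mem x hx').2.2.1 (Finset.mem_inter.1 hx).1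
  have hfnot : f ∉ F ∩ I ∪ S₂ := by
    rw [Finset.mem_union, Finset.mem_inter]
    rintro (h | h)
    · exact hf h.2
    · exact hf (hS₂mem f h).1
  have hG'𝓕 : G' ∈ 𝓕 := by
    refine hst.mem_of_exchange hF ?_ ?_ ?_
    · refine Finset.insert_subset (hFn hfF) (Finset.union_subset ?_ ?_)
      · exact Finset.inter_subset_left.trans hFn
      · exact fun x hx => hIn (hS₂mem x hx).1
    · rw [hG', Finset.card_insert_of_notMem hfnot, Finset.card_union_of_disjoint hdisjS, hFk]
      omega
    · intro x hx y hy
      simp only [hG', Finset.mem_sdiff, Finset.mem_insert, Finset.mem_union,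
        Finset.mem_inter, not_or, not_and] at hx hy
      have hyS : y ∈ S₂ := by
        rcases hy with ⟨rfl | h | h, h'⟩
        · exact absurd hfF h'
        · exact absurd h.1 h'
        · exact h
      exact hout x (hFn hx.1) (hx.2.2.1 hx.1) y (hS₂mem y hyS).1
  have hG'd : ∀ A ∈ M, Disjoint (A.image φ) G' := by
    intro A hA
    refine Finset.disjoint_left.2 fun y hy hyG => ?_
    obtain ⟨x, hx, rfl⟩ := Finset.mem_image.1 hy
    have hxW := hsubW A hA hx
    rw [hG', Finset.mem_insert, Finset.mem_union, htr, Finset.mem_inter] at hyG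
    have hxG : x ∉ G := Finset.disjoint_left.1 hWG hxW
    rcases hyG with h | h | h
    · exact hf (h ▸ hφI x hxW)
    · rcases hφcases x hxW with ⟨-, h2⟩ | ⟨-, h2⟩
      · exact hxG (h2 ▸ h.1)
      · exact (hTmem _ h2).2.2 h.1
    · rcases hφcases x hxW with ⟨-, h2⟩ | ⟨-, h2⟩
      · rw [h2] at h
        exact (hS₂mem x h).2.1 hxW
      · exact (hS₂mem _ h).2.2.2 h2
  have hdimg : ∀ A ∈ M, ∀ B ∈ M, A ≠ B → Disjoint (A.image φ) (B.image φ) := by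
    intro A hA B hB hAB
    refine Finset.disjoint_left.2 fun y hy hy' => ?_
    obtain ⟨a, ha, rfl⟩ := Finset.mem_image.1 hy
    obtain ⟨b, hb, hab⟩ := Finset.mem_image.1 hy'
    have := hinj (hsubW B hB hb) (hsubW A hA ha) hab
    exact Finset.disjoint_left.1 (hd hA hB hAB) ha (this ▸ hb)
  have hinjM : Set.InjOn (Finset.image φ) (M : Set (Finset ℕ)) := by
    intro A hA B hB hAB
    by_contra hne'
    have := hdimg A hA B hB hne'
    rw [← hAB, Finset.disjoint_self_iff_empty, Finset.image_eq_empty] at this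
    exact (hne A hA).ne_empty this
  have hG'not : G' ∉ M.image (Finset.image φ) := by
    intro h
    obtain ⟨A, hA, hAG⟩ := Finset.mem_image.1 h
    have := hG'd A hA
    rw [hAG, Finset.disjoint_self_iff_empty] at this
    exact Finset.insert_ne_empty _ _ this
  have hle := card_le_matchNum (𝓕 := 𝓕) (M := insert G' (M.image (Finset.image φ))) ?_ ?_ ?_
  · rw [Finset.card_insert_of_notMem hG'not, Finset.card_image_of_injOn hinjM] at hle
    omega
  · exact Finset.insert_subset hG'𝓕 (Finset.image_subset_iff.2 hφ𝓕)
  · simp only [Finset.mem_insert, Finset.mem_image]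
    rintro _ (rfl | ⟨A, hA, rfl⟩)
    · exact Finset.insert_nonempty _ _
    · exact (hne A hA).image φ
  · intro A hA B hB hAB
    simp only [Finset.coe_insert, Finset.coe_image, Set.mem_insert_iff, Set.mem_image,
      Finset.mem_coe] at hA hB
    rcases hA with rfl | ⟨A, hA, rfl⟩ <;> rcases hB with rfl | ⟨B, hB, rfl⟩
    · exact absurd rfl hAB
    · exact (hG'd B hB).symm
    · exact hG'd A hA
    · exact hdimg A hA B hB fun h => hAB (h ▸ rfl)

/-- In a stable saturated family, membership of a `k`-set depends only on its trace on
`[ks+k-1]`. -/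
theorem Stable.mem_of_inter_eq {k s n : ℕ} (hn : k * s + k - 1 ≤ n)
    {𝓕 : Finset (Finset ℕ)} (h𝓕 : 𝓕 ⊆ Finset.powersetCard k (Finset.Icc 1 n))
    (hst : Stable n 𝓕) (hsat : Saturated n k 𝓕) (hν : matchNum 𝓕 = s)
    {F G : Finset ℕ} (hF : F ∈ 𝓕) (hG : G ⊆ Finset.Icc 1 n) (hGk : G.card = k)
    (htr : F ∩ Finset.Icc 1 (k * s + k - 1) = G ∩ Finset.Icc 1 (k * s + k - 1)) :
    G ∈ 𝓕 := by
  by_contra hGF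
  have hFk := (Finset.mem_powersetCard.1 (h𝓕 hF)).2
  obtain ⟨M, hM, hcard, hne, hd, hMG⟩ :=
    exists_matching_disjoint_of_matchNum_lt (hsat G hG hGk hGF)
  by_cases hFI : F ⊆ Finset.Icc 1 (k * s + k - 1)
  · rw [Finset.inter_eq_left.2 hFI] at htr
    have hFG : F ⊆ G := htr ▸ Finset.inter_subset_left
    exact hGF (Finset.eq_of_subset_of_card_le hFG (by omega) ▸ hF)
  · obtain ⟨f, hfF, hf⟩ := Finset.not_subset.1 hFI
    exact hst.not_exists_matching_disjoint hn h𝓕 hν hF htr hfF hf hM (hcard.trans hν)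
      hne hd hMG

theorem Finset.card_filter_inter_eq {α : Type*} [DecidableEq α] {H I J : Finset α} (k : ℕ)
    (hH : H ⊆ I) (hHk : H.card ≤ k) (hIJ : I ⊆ J) :
    ((J.powersetCard k).filter fun G => G ∩ I = H).card
      = (J.card - I.card).choose (k - H.card) := by
  rw [← Finset.card_sdiff_of_subset hIJ, ← Finset.card_powersetCard]
  refine Finset.card_bij' (fun G _ => G \ I) (fun K _ => H ∪ K) ?_ ?_ ?_ ?_
  · intro G hG
    obtain ⟨hG', rfl⟩ := Finset.mem_filter.1 hG
    obtain ⟨hGJ, hGk⟩ := Finset.mem_powersetCard.1 hG'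
    refine Finset.mem_powersetCard.2 ⟨Finset.sdiff_subset_sdiff hGJ subset_rfl, ?_⟩
    have := Finset.card_sdiff_add_card_inter G I
    omega
  · intro K hK
    obtain ⟨hKJ, hKk⟩ := Finset.mem_powersetCard.1 hK
    have hKI : Disjoint K I := (Finset.subset_sdiff.1 hKJ).2
    refine Finset.mem_filter.2 ⟨Finset.mem_powersetCard.2 ⟨?_, ?_⟩, ?_⟩
    · exact Finset.union_subset (hH.trans hIJ) (Finset.subset_sdiff.1 hKJ).1
    · rw [Finset.card_union_of_disjoint (hKI.mono_right hH).symm]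
      omega
    · rw [Finset.union_inter_distrib_right, Finset.inter_eq_left.2 hH,
        Finset.disjoint_iff_inter_eq_empty.1 hKI, Finset.union_empty]
  · intro G hG
    obtain ⟨-, rfl⟩ := Finset.mem_filter.1 hG
    rw [Finset.union_comm, Finset.sdiff_union_inter]
  · intro K hK
    have hKI : Disjoint K I := (Finset.subset_sdiff.1 (Finset.mem_powersetCard.1 hK).1).2
    rw [Finset.union_sdiff_distrib, Finset.sdiff_eq_empty_iff_subset.2 hH, Finset.empty_union,
      Finset.sdiff_eq_self_of_disjoint hKI]

theorem Finset.card_filter_superset_powersetCard {α : Type*} [DecidableEq α]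
    {V J : Finset α} (k : ℕ) (hV : V ⊆ J) (hVk : V.card ≤ k) :
    ((J.powersetCard k).filter fun R => V ⊆ R).card
      = (J.card - V.card).choose (k - V.card) := by
  rw [← Finset.card_filter_inter_eq k subset_rfl hVk hV]
  simp only [Finset.inter_eq_right]

/-- The number of members of a pairwise disjoint family that meet `H` is at most `|H|`. -/
theorem Finset.card_filter_inter_nonempty_le {ι α : Type*} [Fintype ι] [DecidableEq α]
    (H : Finset α) {F : ι → Finset α} (hdisj : ∀ i j, i ≠ j → Disjoint (F i) (F j)) :
    (Finset.univ.filter fun i => (H ∩ F i).Nonempty).card ≤ H.card := by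
  classical
  calc (Finset.univ.filter fun i => (H ∩ F i).Nonempty).card
      ≤ ((Finset.univ.filter fun i => (H ∩ F i).Nonempty).biUnion fun i => H ∩ F i).card :=
        Finset.card_le_card_biUnion
          (fun i _ j _ hij => (hdisj i j hij).mono Finset.inter_subset_right
            Finset.inter_subset_right)
          fun i hi => (Finset.mem_filter.1 hi).2
    _ ≤ H.card :=
        Finset.card_le_card (Finset.biUnion_subset.2 fun _ _ => Finset.inter_subset_left)

/-- The Counting Lemma: with `[ks+k−1] = D ∪ F₁ ∪ ⋯ ∪ F_s` a partition into a
`(k−1)`-set `D` and pairwise disjoint members `F₁,…,F_s ∈ 𝓕`, summing the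
weights `w(H) = C(n−ks−k+1, k−|H|) / C(s−v(H), k−v(H))` of the members of the
trace family contained in `X(R) = D ∪ ⋃_{r∈R} F_r`, over all `k`-element
`R ⊆ [s]`, yields `|𝓕|`. -/
theorem counting_lemma (k s n : ℕ) (hk : 1 ≤ k) (hs : k ≤ s)
    (hn : k * s + k - 1 ≤ n)
    (𝓕 : Finset (Finset ℕ)) (h𝓕 : 𝓕 ⊆ Finset.powersetCard k (Finset.Icc 1 n))
    (hst : Stable n 𝓕) (hsat : Saturated n k 𝓕) (hν : matchNum 𝓕 = s)
    (D : Finset ℕ) (F : Fin s → Finset ℕ)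
    (hF : ∀ i, F i ∈ 𝓕) (hD : D.card = k - 1)
    (hdisj : ∀ i j, i ≠ j → Disjoint (F i) (F j))
    (hDdisj : ∀ i, Disjoint D (F i))
    (hcover : D ∪ Finset.univ.biUnion F = Finset.Icc 1 (k * s + k - 1)) :
    (𝓕.card : ℚ) =
      ∑ R ∈ Finset.powersetCard k (Finset.univ : Finset (Fin s)),
        ∑ H ∈ (𝓕.image fun F' => F' ∩ Finset.Icc 1 (k * s + k - 1)).filter
            (fun H => H ⊆ D ∪ R.biUnion F),
          ((n + 1 - (k * s + k)).choose (k - H.card) : ℚ) /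
            ((s - (Finset.univ.filter fun i => (H ∩ F i).Nonempty).card).choose
              (k - (Finset.univ.filter fun i => (H ∩ F i).Nonempty).card) : ℚ) := by
  set I := Finset.Icc 1 (k * s + k - 1) with hI
  have hIn : I ⊆ Finset.Icc 1 n := Finset.Icc_subset_Icc_right hn
  have hfiber : ∀ H ∈ 𝓕.image (fun F' => F' ∩ I),
      (𝓕.filter fun F' => F' ∩ I = H).card = (n + 1 - (k * s + k)).choose (k - H.card) := by
    intro H hH
    obtain ⟨F', hF', rfl⟩ := Finset.mem_image.1 hH
    have hF'k := (Finset.mem_powersetCard.1 (h𝓕 hF')).2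
    have hcard := Finset.card_filter_inter_eq k (Finset.inter_subset_right (s₁ := F'))
      ((Finset.card_le_card Finset.inter_subset_left).trans hF'k.le) hIn
    rw [hI, Nat.card_Icc, Nat.card_Icc, ← hI,
      show n + 1 - 1 - (k * s + k - 1 + 1 - 1) = n + 1 - (k * s + k) by omega] at hcard
    rw [← hcard]
    congr 1
    ext G
    simp only [Finset.mem_filter]
    refine ⟨fun h => ⟨h𝓕 h.1, h.2⟩, fun h => ⟨?_, h.2⟩⟩
    obtain ⟨hGn, hGk⟩ := Finset.mem_powersetCard.1 h.1
    exact hst.mem_of_inter_eq hn h𝓕 hsat hν hF' hGn hGk h.2.symm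
  have hsubset : ∀ H ∈ 𝓕.image (fun F' => F' ∩ I), ∀ R : Finset (Fin s),
      H ⊆ D ∪ R.biUnion F ↔ (Finset.univ.filter fun i => (H ∩ F i).Nonempty) ⊆ R := by
    intro H hH R
    obtain ⟨F', -, rfl⟩ := Finset.mem_image.1 hH
    constructor
    · intro h i hi
      obtain ⟨x, hx⟩ := (Finset.mem_filter.1 hi).2
      obtain ⟨hxH, hxi⟩ := Finset.mem_inter.1 hx
      rcases Finset.mem_union.1 (h hxH) with hxD | hxR
      · exact absurd hxi (Finset.disjoint_left.1 (hDdisj i) hxD)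
      · obtain ⟨j, hj, hxj⟩ := Finset.mem_biUnion.1 hxR
        by_cases hij : i = j
        · exact hij ▸ hj
        · exact absurd hxj (Finset.disjoint_left.1 (hdisj i j hij) hxi)
    · intro h x hx
      have hxI : x ∈ D ∪ Finset.univ.biUnion F := hcover ▸ (Finset.mem_inter.1 hx).2
      rcases Finset.mem_union.1 hxI with hxD | hxU
      · exact Finset.mem_union_left _ hxD
      · obtain ⟨i, -, hxi⟩ := Finset.mem_biUnion.1 hxU
        exact Finset.mem_union_right _ (Finset.mem_biUnion.2 ⟨i, h (Finset.mem_filter.2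
          ⟨Finset.mem_univ i, x, Finset.mem_inter.2 ⟨hx, hxi⟩⟩), hxi⟩)
  rw [Finset.card_eq_sum_card_image (fun F' => F' ∩ I) 𝓕, Nat.cast_sum]
  simp only [Finset.sum_filter]
  rw [Finset.sum_comm]
  refine Finset.sum_congr rfl fun H hH => ?_
  rw [hfiber H hH, ← Finset.sum_filter, Finset.sum_const, nsmul_eq_mul]
  simp only [hsubset H hH]
  have hVk : (Finset.univ.filter fun i => (H ∩ F i).Nonempty).card ≤ k := by
    obtain ⟨F', hF', rfl⟩ := Finset.mem_image.1 hH
    exact (Finset.card_filter_inter_nonempty_le _ hdisj).trans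
      ((Finset.card_le_card Finset.inter_subset_left).trans
        (Finset.mem_powersetCard.1 (h𝓕 hF')).2.le)
  rw [Finset.card_filter_superset_powersetCard k (Finset.subset_univ _) hVk, Finset.card_fin,
    mul_div_cancel₀]
  exact_mod_cast (Nat.choose_pos (by omega)).ne'
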